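/- Main impossibility theorem: if an ES basic fusion operator ∇ satisfies (ESF-SD), (ESF-P) and (ESF-I), then ∇ satisfies (ESF-D), i.e., ∇ is a dictatorial operator. -/

import Mathlib

/- Common framework for logic-based merging of epistemic states
   (Mata Díaz & Pino Pérez, "Impossibility in Belief Merging"). -/

namespace BeliefMerging

/-- A profile: a nonempty finite society of agents together with an
assignment of an epistemic state to each agent of the society. -/
structure Profile (S ℰ : Type) where
  soc : Finset S
  soc_nonempty : soc.Nonempty
  val : {x // x ∈ soc} → ℰ

variable {S ℰ W : Type}

/-- The singleton profile of agent `i` with epistemic state `E`. -/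
def Profile.single (i : S) (E : ℰ) : Profile S ℰ :=
  ⟨{i}, Finset.singleton_nonempty i, fun _ => E⟩

/-- Restriction of a profile to a nonempty subsociety. -/
def Profile.restrict (Φ : Profile S ℰ) (M : Finset S) (hM : M.Nonempty)
    (hsub : M ⊆ Φ.soc) : Profile S ℰ :=
  ⟨M, hM, fun i => Φ.val ⟨i.1, hsub i.2⟩⟩

/-- Equivalence of profiles: societies of the same cardinality whose states
correspond under the unique order-preserving bijection. -/
def Profile.Equiv [LinearOrder S] (Φ Ψ : Profile S ℰ) : Prop :=
  ∃ h : Φ.soc.card = Ψ.soc.card,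
    ∀ k : Fin Φ.soc.card,
      Φ.val (Φ.soc.orderIsoOfFin rfl k) = Ψ.val (Ψ.soc.orderIsoOfFin h.symm k)

/-- (ESF1) -/
def ESF1 (B : ℰ → Set W) (nab : Profile S ℰ → ℰ → ℰ) : Prop :=
  ∀ (Φ : Profile S ℰ) (E : ℰ), B (nab Φ E) ⊆ B E

/-- (ESF2) -/
def ESF2 [LinearOrder S] (B : ℰ → Set W) (nab : Profile S ℰ → ℰ → ℰ) : Prop :=
  ∀ (Φ Φ' : Profile S ℰ) (E E' : ℰ), Profile.Equiv Φ Φ' → B E = B E' →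
    B (nab Φ E) = B (nab Φ' E')

/-- (ESF3) -/
def ESF3 (B : ℰ → Set W) (nab : Profile S ℰ → ℰ → ℰ) : Prop :=
  ∀ (Φ : Profile S ℰ) (E E' E'' : ℰ), B E = B E' ∩ B E'' →
    B (nab Φ E') ∩ B E'' ⊆ B (nab Φ E)

/-- (ESF4) -/
def ESF4 (B : ℰ → Set W) (nab : Profile S ℰ → ℰ → ℰ) : Prop :=
  ∀ (Φ : Profile S ℰ) (E E' E'' : ℰ), B E = B E' ∩ B E'' →
    (B (nab Φ E') ∩ B E'').Nonempty →
    B (nab Φ E) ⊆ B (nab Φ E') ∩ B E''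

/-- ES basic fusion operator: (ESF1)–(ESF4). -/
def BasicFusion [LinearOrder S] (B : ℰ → Set W) (nab : Profile S ℰ → ℰ → ℰ) : Prop :=
  ESF1 B nab ∧ ESF2 B nab ∧ ESF3 B nab ∧ ESF4 B nab

/-- (ESF5) -/
def ESF5 (B : ℰ → Set W) (nab : Profile S ℰ → ℰ → ℰ) : Prop :=
  ∀ (j k : S) (Ej Ek : ℰ), Ej ≠ Ek →
    ∃ E' : ℰ, B (nab (Profile.single j Ej) E') ≠ B (nab (Profile.single k Ek) E')

/-- (ESF6) -/
def ESF6 (B : ℰ → Set W) (nab : Profile S ℰ → ℰ → ℰ) : Prop :=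
  ∀ (Φ : Profile S ℰ) (E : ℰ),
    ((⋂ i : {x // x ∈ Φ.soc}, B (Φ.val i)) ∩ B E).Nonempty →
    B (nab Φ E) = (⋂ i : {x // x ∈ Φ.soc}, B (Φ.val i)) ∩ B E

/-- (ESF7) -/
def ESF7 [DecidableEq S] (B : ℰ → Set W) (nab : Profile S ℰ → ℰ → ℰ) : Prop :=
  ∀ (Φ : Profile S ℰ) (N₁ N₂ : Finset S) (h₁ : N₁.Nonempty) (h₂ : N₂.Nonempty)
    (hs₁ : N₁ ⊆ Φ.soc) (hs₂ : N₂ ⊆ Φ.soc),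
    Disjoint N₁ N₂ → N₁ ∪ N₂ = Φ.soc → ∀ E : ℰ,
      B (nab (Φ.restrict N₁ h₁ hs₁) E) ∩ B (nab (Φ.restrict N₂ h₂ hs₂) E) ⊆
        B (nab Φ E)

/-- (ESF8) -/
def ESF8 [DecidableEq S] (B : ℰ → Set W) (nab : Profile S ℰ → ℰ → ℰ) : Prop :=
  ∀ (Φ : Profile S ℰ) (N₁ N₂ : Finset S) (h₁ : N₁.Nonempty) (h₂ : N₂.Nonempty)
    (hs₁ : N₁ ⊆ Φ.soc) (hs₂ : N₂ ⊆ Φ.soc),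
    Disjoint N₁ N₂ → N₁ ∪ N₂ = Φ.soc → ∀ E : ℰ,
      (B (nab (Φ.restrict N₁ h₁ hs₁) E) ∩ B (nab (Φ.restrict N₂ h₂ hs₂) E)).Nonempty →
      B (nab Φ E) ⊆
        B (nab (Φ.restrict N₁ h₁ hs₁) E) ∩ B (nab (Φ.restrict N₂ h₂ hs₂) E)

/-- (ESF8W) -/
def ESF8W [DecidableEq S] (B : ℰ → Set W) (nab : Profile S ℰ → ℰ → ℰ) : Prop :=
  ∀ (Φ : Profile S ℰ) (N₁ N₂ : Finset S) (h₁ : N₁.Nonempty) (h₂ : N₂.Nonempty)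
    (hs₁ : N₁ ⊆ Φ.soc) (hs₂ : N₂ ⊆ Φ.soc),
    Disjoint N₁ N₂ → N₁ ∪ N₂ = Φ.soc → ∀ E : ℰ,
      (B (nab (Φ.restrict N₁ h₁ hs₁) E) ∩ B (nab (Φ.restrict N₂ h₂ hs₂) E)).Nonempty →
      B (nab Φ E) ⊆
        B (nab (Φ.restrict N₁ h₁ hs₁) E) ∪ B (nab (Φ.restrict N₂ h₂ hs₂) E)

/-- ES fusion operator: (ESF1)–(ESF8). -/
def Fusion [LinearOrder S] (B : ℰ → Set W) (nab : Profile S ℰ → ℰ → ℰ) : Prop :=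
  BasicFusion B nab ∧ ESF5 B nab ∧ ESF6 B nab ∧ ESF7 B nab ∧ ESF8 B nab

/-- ES quasifusion operator: (ESF1)–(ESF7) and (ESF8W). -/
def Quasifusion [LinearOrder S] (B : ℰ → Set W) (nab : Profile S ℰ → ℰ → ℰ) : Prop :=
  BasicFusion B nab ∧ ESF5 B nab ∧ ESF6 B nab ∧ ESF7 B nab ∧ ESF8W B nab

/-- (ESF-SD), Standard Domain. -/
def ESFSD (B : ℰ → Set W) (nab : Profile S ℰ → ℰ → ℰ) : Prop :=
  ∀ (i : S) (w w' w'' : W), w ≠ w' → w ≠ w'' → w' ≠ w'' →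
  ∀ (E₁ E₂ : ℰ), B E₁ = {w, w'} → B E₂ = {w', w''} →
    (∃ Ei : ℰ, B (nab (Profile.single i Ei) E₁) = {w, w'} ∧
               B (nab (Profile.single i Ei) E₂) = {w', w''}) ∧
    (∃ Ei : ℰ, B (nab (Profile.single i Ei) E₁) = {w, w'} ∧
               B (nab (Profile.single i Ei) E₂) = {w'}) ∧
    (∃ Ei : ℰ, B (nab (Profile.single i Ei) E₁) = {w} ∧
               B (nab (Profile.single i Ei) E₂) = {w', w''}) ∧
    (∃ Ei : ℰ, B (nab (Profile.single i Ei) E₁) = {w} ∧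
               B (nab (Profile.single i Ei) E₂) = {w'})

/-- (ESF-U), Unanimity. -/
def ESFU (B : ℰ → Set W) (nab : Profile S ℰ → ℰ → ℰ) : Prop :=
  ∀ (Φ : Profile S ℰ), (∀ i j : {x // x ∈ Φ.soc}, Φ.val i = Φ.val j) →
    ∀ (E : ℰ) (i : {x // x ∈ Φ.soc}),
      B (nab Φ E) = B (nab (Profile.single i.1 (Φ.val i)) E)

/-- (ESF-P), Pareto. -/
def ESFP (B : ℰ → Set W) (nab : Profile S ℰ → ℰ → ℰ) : Prop :=
  ∀ (Φ : Profile S ℰ) (E E' : ℰ),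
    (⋂ i : {x // x ∈ Φ.soc}, B (nab (Profile.single i.1 (Φ.val i)) E)).Nonempty →
    (∀ i : {x // x ∈ Φ.soc}, B (nab (Profile.single i.1 (Φ.val i)) E) ∩ B E' = ∅) →
    B (nab Φ E) ∩ B E' = ∅

/-- (ESF-I), Independence. -/
def ESFI (B : ℰ → Set W) (nab : Profile S ℰ → ℰ → ℰ) : Prop :=
  ∀ (N : Finset S) (hN : N.Nonempty) (f g : {x // x ∈ N} → ℰ) (E : ℰ),
    (∀ E' : ℰ, B E' ⊆ B E → ∀ j : {x // x ∈ N},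
      B (nab (Profile.single j.1 (f j)) E') = B (nab (Profile.single j.1 (g j)) E')) →
    B (nab ⟨N, hN, f⟩ E) = B (nab ⟨N, hN, g⟩ E)

/-- (ESF-D), Dictator. -/
def ESFD (B : ℰ → Set W) (nab : Profile S ℰ → ℰ → ℰ) : Prop :=
  ∀ (N : Finset S) (hN : N.Nonempty), ∃ d : {x // x ∈ N},
    ∀ (f : {x // x ∈ N} → ℰ) (E : ℰ),
      B (nab ⟨N, hN, f⟩ E) ⊆ B (nab (Profile.single d.1 (f d)) E)

/-- The maximal elements of `C` with respect to the total preorder `R`. -/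
def MaxSet (C : Set W) (R : W → W → Prop) : Set W :=
  {w ∈ C | ∀ w' ∈ C, R w w'}

/-- The strict part of a total preorder. -/
def StrictRel (R : W → W → Prop) (a b : W) : Prop := R a b ∧ ¬ R b a

/-- An assignment: each profile is mapped to a total preorder over valuations. -/
def IsAssignment (f : Profile S ℰ → W → W → Prop) : Prop :=
  ∀ Φ : Profile S ℰ, (∀ a b : W, f Φ a b ∨ f Φ b a) ∧
    (∀ a b c : W, f Φ a b → f Φ b c → f Φ a c)

/-- A basic assignment: an assignment sending equivalent profiles to equal preorders. -/
def IsBasicAssignment [LinearOrder S] (f : Profile S ℰ → W → W → Prop) : Prop :=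
  IsAssignment f ∧ ∀ Φ Ψ : Profile S ℰ, Profile.Equiv Φ Ψ → f Φ = f Ψ

/-- The assignment `f` represents the operator `nab`. -/
def Represents (B : ℰ → Set W) (nab : Profile S ℰ → ℰ → ℰ)
    (f : Profile S ℰ → W → W → Prop) : Prop :=
  ∀ (Φ : Profile S ℰ) (E : ℰ), B (nab Φ E) = MaxSet (B E) (f Φ)

/-- Property 1. -/
def Prop1 (f : Profile S ℰ → W → W → Prop) : Prop :=
  ∀ (j k : S) (Ej Ek : ℰ), Ej ≠ Ek →
    f (Profile.single j Ej) ≠ f (Profile.single k Ek)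

/-- Property 2. -/
def Prop2 (B : ℰ → Set W) (f : Profile S ℰ → W → W → Prop) : Prop :=
  ∀ Φ : Profile S ℰ, (⋂ i : {x // x ∈ Φ.soc}, B (Φ.val i)).Nonempty →
    (⋂ i : {x // x ∈ Φ.soc}, B (Φ.val i)) = MaxSet Set.univ (f Φ)

/-- Property 3. -/
def Prop3 [DecidableEq S] (f : Profile S ℰ → W → W → Prop) : Prop :=
  ∀ (Φ : Profile S ℰ) (N₁ N₂ : Finset S) (h₁ : N₁.Nonempty) (h₂ : N₂.Nonempty)
    (hs₁ : N₁ ⊆ Φ.soc) (hs₂ : N₂ ⊆ Φ.soc),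
    Disjoint N₁ N₂ → N₁ ∪ N₂ = Φ.soc → ∀ w w' : W,
      f (Φ.restrict N₁ h₁ hs₁) w w' → f (Φ.restrict N₂ h₂ hs₂) w w' → f Φ w w'

/-- Property 4. -/
def Prop4 [DecidableEq S] (f : Profile S ℰ → W → W → Prop) : Prop :=
  ∀ (Φ : Profile S ℰ) (N₁ N₂ : Finset S) (h₁ : N₁.Nonempty) (h₂ : N₂.Nonempty)
    (hs₁ : N₁ ⊆ Φ.soc) (hs₂ : N₂ ⊆ Φ.soc),
    Disjoint N₁ N₂ → N₁ ∪ N₂ = Φ.soc → ∀ w w' : W,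
      f (Φ.restrict N₁ h₁ hs₁) w w' → StrictRel (f (Φ.restrict N₂ h₂ hs₂)) w w' →
        StrictRel (f Φ) w w'

/-- Property 4′. -/
def Prop4' [DecidableEq S] (f : Profile S ℰ → W → W → Prop) : Prop :=
  ∀ (Φ : Profile S ℰ) (N₁ N₂ : Finset S) (h₁ : N₁.Nonempty) (h₂ : N₂.Nonempty)
    (hs₁ : N₁ ⊆ Φ.soc) (hs₂ : N₂ ⊆ Φ.soc),
    Disjoint N₁ N₂ → N₁ ∪ N₂ = Φ.soc → ∀ w w' : W,
      StrictRel (f (Φ.restrict N₁ h₁ hs₁)) w w' →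
      StrictRel (f (Φ.restrict N₂ h₂ hs₂)) w w' →
        StrictRel (f Φ) w w'

/-- The Maximality Condition. -/
def Maximality (B : ℰ → Set W) (f : Profile S ℰ → W → W → Prop) : Prop :=
  ∀ (i : S) (E : ℰ), B E = MaxSet Set.univ (f (Profile.single i E))

/-- Faithful assignment: basic + Properties 1–4. -/
def IsFaithfulAssignment [LinearOrder S] (B : ℰ → Set W)
    (f : Profile S ℰ → W → W → Prop) : Prop :=
  IsBasicAssignment f ∧ Prop1 f ∧ Prop2 B f ∧ Prop3 f ∧ Prop4 f

/-- Quasifaithful assignment: basic + Properties 1–3 and 4′. -/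
def IsQuasifaithfulAssignment [LinearOrder S] (B : ℰ → Set W)
    (f : Profile S ℰ → W → W → Prop) : Prop :=
  IsBasicAssignment f ∧ Prop1 f ∧ Prop2 B f ∧ Prop3 f ∧ Prop4' f

/-- Property (u). -/
def PropU (f : Profile S ℰ → W → W → Prop) : Prop :=
  ∀ (Φ : Profile S ℰ), (∀ i j : {x // x ∈ Φ.soc}, Φ.val i = Φ.val j) →
    ∀ i : {x // x ∈ Φ.soc}, f Φ = f (Profile.single i.1 (Φ.val i))

/-- Property (p). -/
def PropP (f : Profile S ℰ → W → W → Prop) : Prop :=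
  ∀ (Φ : Profile S ℰ) (w w' : W),
    (∀ i : {x // x ∈ Φ.soc}, StrictRel (f (Profile.single i.1 (Φ.val i))) w w') →
    StrictRel (f Φ) w w'

/-- Two relations coincide on the pair `{w, w'}`. -/
def SameOnPair (R R' : W → W → Prop) (w w' : W) : Prop :=
  (R w w' ↔ R' w w') ∧ (R w' w ↔ R' w' w)

/-- Property (ind). -/
def PropInd (f : Profile S ℰ → W → W → Prop) : Prop :=
  ∀ (N : Finset S) (hN : N.Nonempty) (g g' : {x // x ∈ N} → ℰ) (w w' : W),
    (∀ i : {x // x ∈ N},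
      SameOnPair (f (Profile.single i.1 (g i))) (f (Profile.single i.1 (g' i))) w w') →
    SameOnPair (f ⟨N, hN, g⟩) (f ⟨N, hN, g'⟩) w w'

/-- Property (d). -/
def PropD (f : Profile S ℰ → W → W → Prop) : Prop :=
  ∀ (N : Finset S) (hN : N.Nonempty), ∃ d : {x // x ∈ N},
    ∀ (g : {x // x ∈ N} → ℰ) (w w' : W),
      StrictRel (f (Profile.single d.1 (g d))) w w' → StrictRel (f ⟨N, hN, g⟩) w w'

/-- `D` is a locally decisive `N`-coalition for `E` against `E'`. -/
def LocallyDecisiveFor (B : ℰ → Set W) (nab : Profile S ℰ → ℰ → ℰ)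
    (N : Finset S) (hN : N.Nonempty) (D : Finset S) (hD : D ⊆ N) (E E' : ℰ) : Prop :=
  ∀ f : {x // x ∈ N} → ℰ,
    (∀ i : {x // x ∈ D}, B (nab (Profile.single i.1 (f ⟨i.1, hD i.2⟩)) E) ∩ B E' = ∅) →
    (∀ j : {x // x ∈ N}, j.1 ∉ D → B (nab (Profile.single j.1 (f j)) E) = B E') →
    (⋂ i : {x // x ∈ D}, B (nab (Profile.single i.1 (f ⟨i.1, hD i.2⟩)) E)).Nonempty →
    B (nab ⟨N, hN, f⟩ E) ∩ B E' = ∅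

/-- `D` is a decisive `N`-coalition for `E` against `E'`. -/
def DecisiveFor (B : ℰ → Set W) (nab : Profile S ℰ → ℰ → ℰ)
    (N : Finset S) (hN : N.Nonempty) (D : Finset S) (hD : D ⊆ N) (E E' : ℰ) : Prop :=
  ∀ f : {x // x ∈ N} → ℰ,
    (∀ i : {x // x ∈ D}, B (nab (Profile.single i.1 (f ⟨i.1, hD i.2⟩)) E) ∩ B E' = ∅) →
    (⋂ i : {x // x ∈ D}, B (nab (Profile.single i.1 (f ⟨i.1, hD i.2⟩)) E)).Nonempty →
    B (nab ⟨N, hN, f⟩ E) ∩ B E' = ∅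

/-- `D` is a decisive `N`-coalition. -/
def DecisiveCoalition (B : ℰ → Set W) (nab : Profile S ℰ → ℰ → ℰ)
    (N : Finset S) (hN : N.Nonempty) (D : Finset S) (hD : D ⊆ N) : Prop :=
  ∀ E E' : ℰ, DecisiveFor B nab N hN D hD E E'

end BeliefMerging

namespace BeliefMerging

section Representation

variable {S ℰ W : Type} {B : ℰ → Set W} {nab : Profile S ℰ → ℰ → ℰ}

/-- The preference revealed by the choices from two-element constraints. -/
def RevealedPref (B : ℰ → Set W) (nab : Profile S ℰ → ℰ → ℰ) (Φ : Profile S ℰ) (a b : W) : Prop :=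
  ∃ E, B E = {a, b} ∧ a ∈ B (nab Φ E)

theorem revealedPref_of_mem (hsurj : ∀ A : Set W, A.Nonempty → ∃ E : ℰ, B E = A)
    (h1 : ESF1 B nab) (h3 : ESF3 B nab) {Φ : Profile S ℰ} {E : ℰ} {a b : W}
    (ha : a ∈ B (nab Φ E)) (hb : b ∈ B E) : RevealedPref B nab Φ a b := by
  obtain ⟨E₀, hE₀⟩ := hsurj {a, b} ⟨a, by simp⟩
  have hsub : B E₀ ⊆ B E := by
    rw [hE₀]
    rintro x (rfl | rfl)
    exacts [h1 Φ E ha, hb]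
  exact ⟨E₀, hE₀, h3 Φ E₀ E E₀ (Set.inter_eq_right.2 hsub).symm ⟨ha, by simp [hE₀]⟩⟩

theorem mem_of_revealedPref (h4 : ESF4 B nab) {Φ : Profile S ℰ} {E : ℰ} {a b : W}
    (hab : RevealedPref B nab Φ a b) (hb : b ∈ B (nab Φ E)) (ha : a ∈ B E) (hbE : b ∈ B E) :
    a ∈ B (nab Φ E) := by
  obtain ⟨E₀, hE₀, ha₀⟩ := hab
  have hsub : B E₀ ⊆ B E := by
    rw [hE₀]
    rintro x (rfl | rfl)
    exacts [ha, hbE]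
  exact (h4 Φ E₀ E E₀ (Set.inter_eq_right.2 hsub).symm ⟨b, hb, by simp [hE₀]⟩ ha₀).1

theorem represents_revealedPref (hB : ∀ E : ℰ, (B E).Nonempty)
    (hsurj : ∀ A : Set W, A.Nonempty → ∃ E : ℰ, B E = A)
    (h1 : ESF1 B nab) (h3 : ESF3 B nab) (h4 : ESF4 B nab) :
    Represents B nab (RevealedPref B nab) := by
  intro Φ E
  ext a
  constructor
  · exact fun ha => ⟨h1 Φ E ha, fun b hb => revealedPref_of_mem hsurj h1 h3 ha hb⟩
  · rintro ⟨haE, ha⟩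
    obtain ⟨b, hb⟩ := hB (nab Φ E)
    exact mem_of_revealedPref h4 (ha b (h1 Φ E hb)) hb haE (h1 Φ E hb)

theorem isAssignment_revealedPref (hB : ∀ E : ℰ, (B E).Nonempty)
    (hsurj : ∀ A : Set W, A.Nonempty → ∃ E : ℰ, B E = A)
    (h1 : ESF1 B nab) (h3 : ESF3 B nab) (h4 : ESF4 B nab) :
    IsAssignment (RevealedPref B nab) := by
  refine fun Φ => ⟨fun a b => ?_, fun a b c hab hbc => ?_⟩
  · obtain ⟨E, hE⟩ := hsurj {a, b} ⟨a, by simp⟩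
    obtain ⟨x, hx⟩ := hB (nab Φ E)
    have hxE := h1 Φ E hx
    rw [hE] at hxE
    rcases hxE with rfl | rfl
    · exact Or.inl (revealedPref_of_mem hsurj h1 h3 hx (by simp [hE]))
    · exact Or.inr (revealedPref_of_mem hsurj h1 h3 hx (by simp [hE]))
  · obtain ⟨E, hE⟩ := hsurj {a, b, c} ⟨a, by simp⟩
    have haE : a ∈ B E := by simp [hE]
    have hbE : b ∈ B E := by simp [hE]
    have hcE : c ∈ B E := by simp [hE]
    have hba : b ∈ B (nab Φ E) → a ∈ B (nab Φ E) :=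
      fun h => mem_of_revealedPref h4 hab h haE hbE
    have hcb : c ∈ B (nab Φ E) → b ∈ B (nab Φ E) :=
      fun h => mem_of_revealedPref h4 hbc h hbE hcE
    obtain ⟨x, hx⟩ := hB (nab Φ E)
    have hxE := h1 Φ E hx
    rw [hE] at hxE
    have ha : a ∈ B (nab Φ E) := by
      rcases hxE with rfl | rfl | rfl
      exacts [hx, hba hx, hba (hcb hx)]
    exact revealedPref_of_mem hsurj h1 h3 ha hcE

theorem mem_maxSet_pair {R : W → W → Prop} (hR : ∀ a, R a a) {a b : W} :
    a ∈ MaxSet {a, b} R ↔ R a b := by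
  simp [MaxSet, hR]

theorem SameOnPair.maxSet_eq {R R' : W → W → Prop} {a b : W} (h : SameOnPair R R' a b)
    (hR : ∀ a, R a a) (hR' : ∀ a, R' a a) {C : Set W} (hC : C ⊆ {a, b}) :
    MaxSet C R = MaxSet C R' := by
  have key : ∀ x ∈ C, ∀ y ∈ C, (R x y ↔ R' x y) := by
    intro x hx y hy
    rcases hC hx with rfl | rfl <;> rcases hC hy with rfl | rfl <;>
      simp_all [SameOnPair]
  ext x
  exact and_congr_right fun hx => forall₂_congr fun y hy => key x hx y hy

end Representation

section Arrow

variable {I ℰ W : Type} {r : I → ℰ → W → W → Prop} {s : (I → ℰ) → W → W → Prop}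

/-- A social choice situation meeting the hypotheses of Arrow's theorem: individual preferences `r`
realise every weak order on every triple, and `s` aggregates them. -/
structure IsArrovian (r : I → ℰ → W → W → Prop) (s : (I → ℰ) → W → W → Prop) : Prop where
  total_indiv : ∀ i E a b, r i E a b ∨ r i E b a
  total : ∀ f a b, s f a b ∨ s f b a
  trans : ∀ f a b c, s f a b → s f b c → s f a c
  domain : ∀ i (a b c : W), a ≠ b → a ≠ c → b ≠ c → ∀ α β γ : ℕ, ∃ E,
    (r i E a b ↔ β ≤ α) ∧ (r i E b a ↔ α ≤ β) ∧ (r i E b c ↔ γ ≤ β) ∧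
    (r i E c b ↔ β ≤ γ) ∧ (r i E a c ↔ γ ≤ α) ∧ (r i E c a ↔ α ≤ γ)
  pareto : ∀ f a b, (∀ i, StrictRel (r i (f i)) a b) → StrictRel (s f) a b
  indep : ∀ f g a b, (∀ i, SameOnPair (r i (f i)) (r i (g i)) a b) → SameOnPair (s f) (s g) a b

/-- `D` is weakly decisive for `a` over `b`: it imposes `a > b` against unanimous opposition. -/
def WeaklyDecisive (r : I → ℰ → W → W → Prop) (s : (I → ℰ) → W → W → Prop) (D : Finset I)
    (a b : W) : Prop :=
  ∀ f, (∀ i ∈ D, StrictRel (r i (f i)) a b) → (∀ i ∉ D, StrictRel (r i (f i)) b a) →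
    StrictRel (s f) a b

/-- `D` is decisive for `a` over `b`: it imposes `a > b` whatever the others prefer. -/
def Decisive (r : I → ℰ → W → W → Prop) (s : (I → ℰ) → W → W → Prop) (D : Finset I)
    (a b : W) : Prop :=
  ∀ f, (∀ i ∈ D, StrictRel (r i (f i)) a b) → StrictRel (s f) a b

theorem Decisive.weaklyDecisive {D : Finset I} {a b : W} (h : Decisive r s D a b) :
    WeaklyDecisive r s D a b :=
  fun f hf _ => h f hf

namespace IsArrovian

theorem strictRel_of_sameOnPair (h : IsArrovian r s) {f g : I → ℰ} {a b : W}
    (hfg : ∀ i, SameOnPair (r i (f i)) (r i (g i)) a b) (hf : StrictRel (s f) a b) :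
    StrictRel (s g) a b := by
  have := h.indep f g a b hfg
  exact ⟨this.1.1 hf.1, fun hg => hf.2 (this.2.2 hg)⟩

theorem strictRel_trans (h : IsArrovian r s) {f : I → ℰ} {a b c : W}
    (hab : StrictRel (s f) a b) (hbc : StrictRel (s f) b c) : StrictRel (s f) a c :=
  ⟨h.trans f a b c hab.1 hbc.1, fun hca => hab.2 (h.trans f b c a hbc.1 hca)⟩

theorem weaklyDecisive_of_strictRel (h : IsArrovian r s) {D : Finset I} {f : I → ℰ} {a b : W}
    (hD : ∀ i ∈ D, StrictRel (r i (f i)) a b) (hD' : ∀ i ∉ D, StrictRel (r i (f i)) b a)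
    (hf : StrictRel (s f) a b) : WeaklyDecisive r s D a b := by
  intro g hg hg'
  refine h.strictRel_of_sameOnPair (fun i => ?_) hf
  by_cases hi : i ∈ D
  · have h₁ := hD i hi
    have h₂ := hg i hi
    simp_all [StrictRel, SameOnPair]
  · have h₁ := hD' i hi
    have h₂ := hg' i hi
    simp_all [StrictRel, SameOnPair]

theorem decisive_right (h : IsArrovian r s) {D : Finset I} {a b c : W} (hab : a ≠ b)
    (hac : a ≠ c) (hbc : b ≠ c) (hD : WeaklyDecisive r s D a b) : Decisive r s D a c := by
  classical
  intro f hf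
  choose g hg using fun i => h.domain i a b c hab hac hbc
    (if i ∈ D then 3 else if r i (f i) a c then 1 else 0) 2
    (if i ∈ D then 1 else if r i (f i) c a then 1 else 0)
  have hsab : StrictRel (s g) a b := hD g
    (fun i hi => by have := hg i; simp_all [StrictRel])
    (fun i hi => by have := hg i; simp only [StrictRel]; grind)
  have hsbc : StrictRel (s g) b c := h.pareto g b c fun i => by
    have := hg i; simp only [StrictRel]; grind
  refine h.strictRel_of_sameOnPair (fun i => ?_) (h.strictRel_trans hsab hsbc)
  have h₁ := hg i
  have h₂ := hf i
  have h₃ := h.total_indiv i (f i) a c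
  simp only [StrictRel, SameOnPair] at *
  grind

theorem decisive_left (h : IsArrovian r s) {D : Finset I} {a b c : W} (hab : a ≠ b)
    (hac : a ≠ c) (hbc : b ≠ c) (hD : WeaklyDecisive r s D a b) : Decisive r s D c b := by
  classical
  intro f hf
  choose g hg using fun i => h.domain i a b c hab hac hbc 1
    (if i ∈ D then 0 else if r i (f i) b c then 3 else 2)
    (if i ∈ D then 2 else if r i (f i) c b then 3 else 2)
  have hsab : StrictRel (s g) a b := hD g
    (fun i hi => by have := hg i; simp_all [StrictRel])
    (fun i hi => by have := hg i; simp only [StrictRel]; grind)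
  have hsca : StrictRel (s g) c a := h.pareto g c a fun i => by
    have := hg i; simp only [StrictRel]; grind
  refine h.strictRel_of_sameOnPair (fun i => ?_) (h.strictRel_trans hsca hsab)
  have h₁ := hg i
  have h₂ := hf i
  have h₃ := h.total_indiv i (f i) c b
  simp only [StrictRel, SameOnPair] at *
  grind

theorem decisive_of_weaklyDecisive (h : IsArrovian r s)
    (hW : ∀ x y : W, ∃ z, z ≠ x ∧ z ≠ y) {D : Finset I} {a b : W} (hab : a ≠ b)
    (hD : WeaklyDecisive r s D a b) {x y : W} (hxy : x ≠ y) : Decisive r s D x y := by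
  have from_a : ∀ z, z ≠ a → Decisive r s D a z := by
    intro z hz
    by_cases hzb : z = b
    · subst hzb
      obtain ⟨c, hca, hcz⟩ := hW a z
      exact h.decisive_right hca.symm hab hcz
        (h.decisive_right hab hca.symm hcz.symm hD).weaklyDecisive
    · exact h.decisive_right hab hz.symm (Ne.symm hzb) hD
  by_cases hxa : x = a
  · subst hxa
    exact from_a y hxy.symm
  by_cases hya : y = a
  · subst hya
    obtain ⟨c, hcy, hcx⟩ := hW y x
    exact h.decisive_right hcx.symm hxy hcy
      (h.decisive_left hcy.symm (Ne.symm hxa) hcx (from_a c hcy).weaklyDecisive).weaklyDecisive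
  · exact h.decisive_left (Ne.symm hya) (Ne.symm hxa) hxy.symm (from_a y hya).weaklyDecisive

/-- Arrow's theorem on a domain realising every weak order on every triple. -/
theorem exists_dictator [Finite I] [Nonempty W] (h : IsArrovian r s)
    (hW : ∀ x y : W, ∃ z, z ≠ x ∧ z ≠ y) :
    ∃ d, ∀ f a b, StrictRel (r d (f d)) a b → StrictRel (s f) a b := by
  classical
  cases nonempty_fintype I
  have hex : ∃ D : Finset I, ∃ a b : W, a ≠ b ∧ WeaklyDecisive r s D a b := by
    obtain ⟨a⟩ := ‹Nonempty W›
    obtain ⟨b, hb, -⟩ := hW a a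
    exact ⟨Finset.univ, a, b, hb.symm, fun f hf _ => h.pareto f a b fun i => hf i (by simp)⟩
  obtain ⟨D, hDmin⟩ := exists_minimal_of_wellFoundedLT
    (fun D : Finset I => ∃ a b : W, a ≠ b ∧ WeaklyDecisive r s D a b) hex
  obtain ⟨a, b, hab, hD⟩ := hDmin.prop
  obtain ⟨c, hca, hcb⟩ := hW a b
  obtain rfl | ⟨d, hd⟩ := D.eq_empty_or_nonempty
  · choose g hg using fun i => h.domain i a b c hab hca.symm hcb.symm 0 1 0
    have hba : ∀ i, StrictRel (r i (g i)) b a := fun i => by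
      have := hg i; simp_all [StrictRel]
    exact absurd (hD g (by simp) fun i _ => hba i).1 (h.pareto g b a hba).2
  choose g hg using fun i => h.domain i a b c hab hca.symm hcb.symm
    (if i = d then 2 else if i ∈ D then 1 else 0)
    (if i = d then 1 else if i ∈ D then 0 else 2)
    (if i = d then 0 else if i ∈ D then 2 else 1)
  have hsab : StrictRel (s g) a b := h.decisive_of_weaklyDecisive hW hab hD hab g fun i hi => by
    have := hg i; simp only [StrictRel]; grind
  have hsac : StrictRel (s g) a c := by
    by_contra hsac
    have hsca : s g c a := by
      have := h.total g a c
      simp only [StrictRel] at hsac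
      tauto
    have hscb : StrictRel (s g) c b :=
      ⟨h.trans g c a b hsca hsab.1, fun hbc => hsab.2 (h.trans g b c a hbc hsca)⟩
    have hwd : WeaklyDecisive r s (D.erase d) c b := h.weaklyDecisive_of_strictRel
      (fun i hi => by have := hg i; simp only [StrictRel]; grind)
      (fun i hi => by have := hg i; simp only [StrictRel]; grind) hscb
    exact hDmin.not_prop_of_lt (Finset.erase_ssubset hd) ⟨c, b, hcb, hwd⟩
  have hwd : WeaklyDecisive r s {d} a c := h.weaklyDecisive_of_strictRel
    (fun i hi => by have := hg i; simp only [StrictRel]; grind)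
    (fun i hi => by have := hg i; simp only [StrictRel]; grind) hsac
  refine ⟨d, fun f x y hxy => ?_⟩
  have hne : x ≠ y := by
    rintro rfl
    exact hxy.2 hxy.1
  exact h.decisive_of_weaklyDecisive hW hca.symm hwd hne f (by simpa using hxy)

end IsArrovian

end Arrow

section Translation

variable {S ℰ W : Type} {B : ℰ → Set W} {nab : Profile S ℰ → ℰ → ℰ}
  {R : Profile S ℰ → W → W → Prop}

theorem ESFSD.exists_chain (hsd : ESFSD B nab)
    (hsurj : ∀ A : Set W, A.Nonempty → ∃ E : ℰ, B E = A)
    (hR : IsAssignment R) (hrep : Represents B nab R) (i : S) {a b c : W}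
    (hab : a ≠ b) (hac : a ≠ c) (hbc : b ≠ c) (p q : Prop) :
    ∃ E, R (Profile.single i E) a b ∧ R (Profile.single i E) b c ∧
      (R (Profile.single i E) b a ↔ p) ∧ (R (Profile.single i E) c b ↔ q) := by
  obtain ⟨E₁, h₁⟩ := hsurj {a, b} ⟨a, by simp⟩
  obtain ⟨E₂, h₂⟩ := hsurj {b, c} ⟨b, by simp⟩
  have hmem : ∀ (Φ : Profile S ℰ) {E : ℰ} {x y : W}, B E = {x, y} →
      (R Φ x y ↔ x ∈ B (nab Φ E)) ∧ (R Φ y x ↔ y ∈ B (nab Φ E)) := by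
    intro Φ E x y hE
    have hrefl : ∀ z, R Φ z z := fun z => or_self_iff.1 ((hR Φ).1 z z)
    rw [hrep Φ E, hE, mem_maxSet_pair hrefl, Set.pair_comm, mem_maxSet_pair hrefl]
    exact ⟨Iff.rfl, Iff.rfl⟩
  obtain ⟨⟨F₁, hF₁⟩, ⟨F₂, hF₂⟩, ⟨F₃, hF₃⟩, ⟨F₄, hF₄⟩⟩ := hsd i a b c hab hac hbc E₁ E₂ h₁ h₂
  have key : ∀ F, (a ∈ B (nab (Profile.single i F) E₁) ∧ b ∈ B (nab (Profile.single i F) E₂) ∧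
      (b ∈ B (nab (Profile.single i F) E₁) ↔ p) ∧ (c ∈ B (nab (Profile.single i F) E₂) ↔ q)) →
      ∃ E, R (Profile.single i E) a b ∧ R (Profile.single i E) b c ∧
        (R (Profile.single i E) b a ↔ p) ∧ (R (Profile.single i E) c b ↔ q) := by
    intro F hF
    refine ⟨F, ?_⟩
    rwa [(hmem _ h₁).1, (hmem _ h₁).2, (hmem _ h₂).1, (hmem _ h₂).2]
  by_cases hp : p <;> by_cases hq : q
  · exact key F₁ (by simp [hF₁, hp, hq])
  · exact key F₂ (by simp [hF₂, hp, hq, hbc.symm])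
  · exact key F₃ (by simp [hF₃, hp, hq, hab.symm])
  · exact key F₄ (by simp [hF₄, hp, hq, hab.symm, hbc.symm])

theorem ESFSD.exists_ranking (hsd : ESFSD B nab)
    (hsurj : ∀ A : Set W, A.Nonempty → ∃ E : ℰ, B E = A)
    (hR : IsAssignment R) (hrep : Represents B nab R) (i : S) {a b c : W}
    (hab : a ≠ b) (hac : a ≠ c) (hbc : b ≠ c) (α β γ : ℕ) :
    ∃ E, (R (Profile.single i E) a b ↔ β ≤ α) ∧ (R (Profile.single i E) b a ↔ α ≤ β) ∧
      (R (Profile.single i E) b c ↔ γ ≤ β) ∧ (R (Profile.single i E) c b ↔ β ≤ γ) ∧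
      (R (Profile.single i E) a c ↔ γ ≤ α) ∧ (R (Profile.single i E) c a ↔ α ≤ γ) := by
  have sorted : ∀ {x y z : W} {ξ η ζ : ℕ}, x ≠ y → x ≠ z → y ≠ z → η ≤ ξ → ζ ≤ η →
      ∃ E, (R (Profile.single i E) x y ↔ η ≤ ξ) ∧ (R (Profile.single i E) y x ↔ ξ ≤ η) ∧
        (R (Profile.single i E) y z ↔ ζ ≤ η) ∧ (R (Profile.single i E) z y ↔ η ≤ ζ) ∧
        (R (Profile.single i E) x z ↔ ζ ≤ ξ) ∧ (R (Profile.single i E) z x ↔ ξ ≤ ζ) := by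
    intro x y z ξ η ζ hxy hxz hyz h₁ h₂
    obtain ⟨E, e₁, e₂, e₃, e₄⟩ :=
      hsd.exists_chain hsurj hR hrep i hxy hxz hyz (ξ ≤ η) (η ≤ ζ)
    have htr := (hR (Profile.single i E)).2
    refine ⟨E, by tauto, e₃, by tauto, e₄, iff_of_true (htr x y z e₁ e₂) (h₂.trans h₁),
      fun hzx => ?_, fun hle => ?_⟩
    · have := e₃.1 (htr y z x e₂ hzx)
      have := e₄.1 (htr z x y hzx e₁)
      omega
    · exact htr z y x (e₄.2 (by omega)) (e₃.2 (by omega))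
  rcases le_total α β with h₁ | h₁ <;> rcases le_total β γ with h₂ | h₂ <;>
    rcases le_total α γ with h₃ | h₃
  · obtain ⟨E, e₁, e₂, e₃, e₄, e₅, e₆⟩ := sorted hbc.symm hac.symm hab.symm h₂ h₁
    refine ⟨E, ?_, ?_, ?_, ?_, ?_, ?_⟩ <;> assumption
  · obtain ⟨E, e₁, e₂, e₃, e₄, e₅, e₆⟩ := sorted hbc.symm hac.symm hab.symm h₂ h₁
    refine ⟨E, ?_, ?_, ?_, ?_, ?_, ?_⟩ <;> assumption
  · obtain ⟨E, e₁, e₂, e₃, e₄, e₅, e₆⟩ := sorted hbc hab.symm hac.symm h₂ h₃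
    refine ⟨E, ?_, ?_, ?_, ?_, ?_, ?_⟩ <;> assumption
  · obtain ⟨E, e₁, e₂, e₃, e₄, e₅, e₆⟩ := sorted hab.symm hbc hac h₁ h₃
    refine ⟨E, ?_, ?_, ?_, ?_, ?_, ?_⟩ <;> assumption
  · obtain ⟨E, e₁, e₂, e₃, e₄, e₅, e₆⟩ := sorted hac.symm hbc.symm hab h₃ h₁
    refine ⟨E, ?_, ?_, ?_, ?_, ?_, ?_⟩ <;> assumption
  · obtain ⟨E, e₁, e₂, e₃, e₄, e₅, e₆⟩ := sorted hac hab hbc.symm h₃ h₂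
    refine ⟨E, ?_, ?_, ?_, ?_, ?_, ?_⟩ <;> assumption
  · obtain ⟨E, e₁, e₂, e₃, e₄, e₅, e₆⟩ := sorted hab hac hbc h₁ h₂
    refine ⟨E, ?_, ?_, ?_, ?_, ?_, ?_⟩ <;> assumption
  · obtain ⟨E, e₁, e₂, e₃, e₄, e₅, e₆⟩ := sorted hab hac hbc h₁ h₂
    refine ⟨E, ?_, ?_, ?_, ?_, ?_, ?_⟩ <;> assumption

theorem ESFP.propP (hp : ESFP B nab) (hsurj : ∀ A : Set W, A.Nonempty → ∃ E : ℰ, B E = A)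
    (hR : IsAssignment R) (hrep : Represents B nab R) : PropP R := by
  intro Φ a b h
  have hrefl : ∀ Ψ z, R Ψ z z := fun Ψ z => or_self_iff.1 ((hR Ψ).1 z z)
  obtain ⟨E, hE⟩ := hsurj {a, b} ⟨a, by simp⟩
  obtain ⟨E', hE'⟩ := hsurj {b} ⟨b, by simp⟩
  have hmem : ∀ Ψ, b ∈ B (nab Ψ E) ↔ R Ψ b a := by
    intro Ψ
    rw [hrep Ψ E, hE, Set.pair_comm, mem_maxSet_pair (hrefl Ψ)]
  have hempty := hp Φ E E'
    ⟨a, Set.mem_iInter.2 fun i => by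
      rw [hrep _ E, hE, mem_maxSet_pair (hrefl _)]; exact (h i).1⟩
    fun i => by
      rw [hE', Set.inter_singleton_eq_empty, hmem]; exact (h i).2
  rw [hE', Set.inter_singleton_eq_empty, hmem] at hempty
  exact ⟨((hR Φ).1 a b).resolve_right hempty, hempty⟩

theorem ESFI.propInd (hi : ESFI B nab) (hsurj : ∀ A : Set W, A.Nonempty → ∃ E : ℰ, B E = A)
    (hR : IsAssignment R) (hrep : Represents B nab R) : PropInd R := by
  intro N hN f g a b h
  have hrefl : ∀ Ψ z, R Ψ z z := fun Ψ z => or_self_iff.1 ((hR Ψ).1 z z)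
  obtain ⟨E, hE⟩ := hsurj {a, b} ⟨a, by simp⟩
  have heq := hi N hN f g E fun E' hE' j => by
    rw [hrep _ E', hrep _ E']
    exact (h j).maxSet_eq (hrefl _) (hrefl _) (hE ▸ hE')
  rw [hrep _ E, hrep _ E, hE] at heq
  constructor
  · rw [← mem_maxSet_pair (hrefl _), heq, mem_maxSet_pair (hrefl _)]
  · rw [Set.pair_comm] at heq
    rw [← mem_maxSet_pair (hrefl _), heq, mem_maxSet_pair (hrefl _)]

theorem PropD.esfd (hd : PropD R) (hR : IsAssignment R) (hrep : Represents B nab R) :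
    ESFD B nab := by
  intro N hN
  obtain ⟨d, hd⟩ := hd N hN
  refine ⟨d, fun f E a ha => ?_⟩
  rw [hrep] at ha ⊢
  refine ⟨ha.1, fun b hb => ?_⟩
  by_contra hab
  exact (hd f b a ⟨((hR _).1 a b).resolve_left hab, hab⟩).2 (ha.2 b hb)

end Translation

end BeliefMerging

open BeliefMerging in
/-- Main impossibility theorem: an ES basic fusion operator satisfying
Standard Domain, Pareto and Independence is dictatorial. -/
theorem main_impossibility
    {S ℰ W : Type} [LinearOrder S] [Nonempty S] [Fintype W] [Nonempty W]
    (hcard : 4 ≤ Fintype.card W)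
    (B : ℰ → Set W) (hB : ∀ E : ℰ, (B E).Nonempty)
    (hsurj : ∀ A : Set W, A.Nonempty → ∃ E : ℰ, B E = A)
    (nab : Profile S ℰ → ℰ → ℰ) (hbf : BasicFusion B nab)
    (hsd : ESFSD B nab) (hp : ESFP B nab) (hi : ESFI B nab) :
    ESFD B nab := by
  obtain ⟨h1, -, h3, h4⟩ := hbf
  have hR := isAssignment_revealedPref hB hsurj h1 h3 h4
  have hrep := represents_revealedPref hB hsurj h1 h3 h4
  have hW : ∀ x y : W, ∃ z, z ≠ x ∧ z ≠ y := by
    classical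
    intro x y
    obtain ⟨z, -, hz⟩ := Finset.exists_mem_notMem_of_card_lt_card
      (s := {x, y}) (t := (Finset.univ : Finset W))
      (Finset.card_le_two.trans_lt (by rw [Finset.card_univ]; omega))
    exact ⟨z, by simpa using hz⟩
  refine PropD.esfd (fun N hN => ?_) hR hrep
  exact IsArrovian.exists_dictator
    (r := fun (i : {x // x ∈ N}) E => RevealedPref B nab (Profile.single i.1 E))
    (s := fun f => RevealedPref B nab ⟨N, hN, f⟩)
    { total_indiv := fun i E => (hR _).1
      total := fun f => (hR _).1
      trans := fun f => (hR _).2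
      domain := fun i a b c hab hac hbc => hsd.exists_ranking hsurj hR hrep i.1 hab hac hbc
      pareto := fun f => hp.propP hsurj hR hrep ⟨N, hN, f⟩
      indep := hi.propInd hsurj hR hrep N hN } hW
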